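/- arXiv:1507.01215 — 2 statements merged into one kernel-verified Lean document; each statement's English description precedes it below -/
import Mathlib

section
/- Let C = {ℕ} ∪ { {0,...,e} ∪ {2x : 2x > e} : e ∈ ℕ }. Then there is a single learner which simultaneously is consistent (Cons), approximately (Approx) learns C, and partially (Part) learns C; but C is not BC* learnable. -/
open Filter

/-- The `e`-th partial recursive function in a fixed acceptable numbering. -/
def phi (e : ℕ) : ℕ →. ℕ := Nat.Partrec.Code.eval (Denumerable.ofNat Nat.Partrec.Code e)

/-- The `e`-th recursively enumerable set, `W_e = dom(φ_e)`. -/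
def Wset (e : ℕ) : Set ℕ := (phi e).Dom

/-- `T` is a text for `L`: the natural numbers occurring in `T` are exactly
the members of `L` (`none` plays the role of the pause symbol `#`). -/
def IsText (T : ℕ → Option ℕ) (L : Set ℕ) : Prop :=
  {x : ℕ | ∃ n, T n = some x} = L

/-- The finite sequence `T[n] = T(0), ..., T(n-1)`. -/
def pref (T : ℕ → Option ℕ) (n : ℕ) : List (Option ℕ) :=
  (List.range n).map T

/-- `M` partially (Part) learns `C`: on every text for every `L ∈ C` there is
exactly one index output infinitely often, and that index is an index of `L`. -/
def PartLearns (M : List (Option ℕ) → ℕ) (C : Set (Set ℕ)) : Prop :=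
  ∀ L ∈ C, ∀ T : ℕ → Option ℕ, IsText T L →
    ∃ e, {n | M (pref T n) = e}.Infinite ∧ Wset e = L ∧
      ∀ d, {n | M (pref T n) = d}.Infinite → d = e

/-- `M` is consistent (Cons): every number occurring in `σ` belongs to `W_{M(σ)}`. -/
def ConsLearner (M : List (Option ℕ) → ℕ) : Prop :=
  ∀ σ : List (Option ℕ), ∀ x : ℕ, some x ∈ σ → x ∈ Wset (M σ)

/-- `M` finitely approximately (FinApprox) learns `C`. -/
def FinApproxLearns (M : List (Option ℕ) → ℕ) (C : Set (Set ℕ)) : Prop :=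
  ∀ L ∈ C, ∀ T : ℕ → Option ℕ, IsText T L → ∀ D : Finset ℕ,
    ∀ᶠ n in atTop, Wset (M (pref T n)) ∩ ↑D = L ∩ ↑D

/-- `M` BC*-learns `C`: almost all hypotheses are finite variants of the target. -/
def BCstarLearns (M : List (Option ℕ) → ℕ) (C : Set (Set ℕ)) : Prop :=
  ∀ L ∈ C, ∀ T : ℕ → Option ℕ, IsText T L →
    ∀ᶠ n in atTop, (symmDiff (Wset (M (pref T n))) L).Finite

/-- `M` BC^k-learns `C`: almost all hypotheses differ from the target in at
most `k` elements. -/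
def BCnLearns (k : ℕ) (M : List (Option ℕ) → ℕ) (C : Set (Set ℕ)) : Prop :=
  ∀ L ∈ C, ∀ T : ℕ → Option ℕ, IsText T L →
    ∀ᶠ m in atTop, (symmDiff (Wset (M (pref T m))) L).Finite ∧
      (symmDiff (Wset (M (pref T m))) L).ncard ≤ k

/-- `M` behaviourally correctly (BC) learns `C`. -/
def BCLearns (M : List (Option ℕ) → ℕ) (C : Set (Set ℕ)) : Prop :=
  ∀ L ∈ C, ∀ T : ℕ → Option ℕ, IsText T L →
    ∀ᶠ n in atTop, Wset (M (pref T n)) = L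

/-- `M` explanatorily (Ex) learns `C`. -/
def ExLearns (M : List (Option ℕ) → ℕ) (C : Set (Set ℕ)) : Prop :=
  ∀ L ∈ C, ∀ T : ℕ → Option ℕ, IsText T L →
    ∃ e n₀, Wset e = L ∧ ∀ n ≥ n₀, M (pref T n) = e

/-- `M` weakly approximately (WeakApprox) learns `C`: for every text there is
an infinite set `W` such that on every finite variant `V` of `W` almost all
hypotheses agree with the target. -/
def WeakApproxLearns (M : List (Option ℕ) → ℕ) (C : Set (Set ℕ)) : Prop :=
  ∀ L ∈ C, ∀ T : ℕ → Option ℕ, IsText T L →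
    ∃ W : Set ℕ, W.Infinite ∧ ∀ V : Set ℕ, (symmDiff V W).Finite →
      ∀ᶠ n in atTop, Wset (M (pref T n)) ∩ V = L ∩ V

/-- `M` approximately (Approx) learns `C`: for every `L ∈ C` there is an
infinite set `W`, good for all texts for `L`. -/
def ApproxLearns (M : List (Option ℕ) → ℕ) (C : Set (Set ℕ)) : Prop :=
  ∀ L ∈ C, ∃ W : Set ℕ, W.Infinite ∧ ∀ T : ℕ → Option ℕ, IsText T L →
    ∀ V : Set ℕ, (symmDiff V W).Finite →
      ∀ᶠ n in atTop, Wset (M (pref T n)) ∩ V = L ∩ V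

/-- Conservativeness for partial learners: on each text for every `L ∈ C`, `M`
outputs exactly one index `e` with `L ⊆ W_e`. -/
def ConsvLearner (M : List (Option ℕ) → ℕ) (C : Set (Set ℕ)) : Prop :=
  ∀ L ∈ C, ∀ T : ℕ → Option ℕ, IsText T L →
    ∃! e, (∃ n, M (pref T n) = e) ∧ L ⊆ Wset e

/-- Confidence: on every infinite sequence, `M` outputs exactly one index
infinitely often. -/
def Confident (M : List (Option ℕ) → ℕ) : Prop :=
  ∀ T : ℕ → Option ℕ, ∃! e, {n | M (pref T n) = e}.Infinite

/-- The sets ever conjectured by `M` (used to express prudence). -/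
def Conjectured (M : List (Option ℕ) → ℕ) : Set (Set ℕ) :=
  {S | ∃ σ : List (Option ℕ), S = Wset (M σ)}

/-- The class `{ℕ} ∪ { {0,...,e} ∪ {2x : 2x > e} : e ∈ ℕ }`. -/
def evenTailClass : Set (Set ℕ) :=
  {Set.univ} ∪ {L : Set ℕ | ∃ e : ℕ,
    L = {y | y ≤ e} ∪ {y | ∃ x : ℕ, y = 2 * x ∧ e < 2 * x}}

/-- The set `{0,...,k}` together with all even numbers. -/
def evenTail (k : ℕ) : Set ℕ := {y | y ≤ k ∨ y % 2 = 0}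

theorem mem_evenTailClass_iff (L : Set ℕ) :
    L ∈ evenTailClass ↔ L = Set.univ ∨ ∃ e, L = evenTail e := by
  have h : ∀ e : ℕ, {y | y ≤ e} ∪ {y | ∃ x : ℕ, y = 2 * x ∧ e < 2 * x} = evenTail e := by
    intro e
    ext y
    simp only [evenTail, Set.mem_union, Set.mem_ofPred_eq]
    constructor
    · rintro (h | ⟨x, rfl, -⟩)
      · exact Or.inl h
      · right; omega
    · rintro (h | h)
      · exact Or.inl h
      · by_cases hy : y ≤ e
        · exact Or.inl hy
        · exact Or.inr ⟨y / 2, by omega, by omega⟩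
  simp only [evenTailClass, Set.mem_union, Set.mem_singleton_iff, Set.mem_ofPred_eq, h]

theorem infinite_compl_evenTail (e : ℕ) : (evenTail e)ᶜ.Infinite := by
  refine Set.infinite_of_not_bddAbove ?_
  rintro ⟨b, hb⟩
  have : 2 * (e + b) + 1 ∈ (evenTail e)ᶜ := by
    simp only [evenTail, Set.mem_compl_iff, Set.mem_ofPred_eq]
    omega
  have := hb this
  omega

theorem evenTail_ne_univ (e : ℕ) : evenTail e ≠ Set.univ := by
  intro h
  simpa [h] using infinite_compl_evenTail e

theorem pref_succ (T : ℕ → Option ℕ) (n : ℕ) : pref T (n + 1) = pref T n ++ [T n] := by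
  simp [pref, List.range_succ]

theorem mem_pref {T : ℕ → Option ℕ} {n : ℕ} {o : Option ℕ} :
    o ∈ pref T n ↔ ∃ i < n, T i = o := by
  simp [pref]

/-- Indices for the sets `evenTail k` can be computed from `k`. -/
theorem exists_computable_index_evenTail :
    ∃ g : ℕ → ℕ, Computable g ∧ ∀ k, Wset (g k) = evenTail k := by
  have hp : PrimrecPred fun p : ℕ × ℕ => p.2 ≤ p.1 ∨ p.2 % 2 = 0 :=
    PrimrecPred.or (Primrec.nat_le.comp Primrec.snd Primrec.fst)
      (Primrec.eq.comp (Primrec.nat_mod.comp Primrec.snd (Primrec.const 2)) (Primrec.const 0))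
  have hd : Computable fun p : ℕ × ℕ => decide (p.2 ≤ p.1 ∨ p.2 % 2 = 0) :=
    hp.decide.to_comp
  have hf : Partrec fun p : ℕ × ℕ =>
      bif decide (p.2 ≤ p.1 ∨ p.2 % 2 = 0) then Part.some 0 else (Part.none : Part ℕ) :=
    Partrec.cond hd (Computable.const 0) Partrec.none
  have hf' : Partrec fun m : ℕ =>
      bif decide (m.unpair.2 ≤ m.unpair.1 ∨ m.unpair.2 % 2 = 0) then Part.some 0
        else (Part.none : Part ℕ) :=
    hf.comp Primrec.unpair.to_comp
  obtain ⟨c, hc⟩ := Nat.Partrec.Code.exists_code.1 (Partrec.nat_iff.1 hf')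
  refine ⟨fun k => Encodable.encode (Nat.Partrec.Code.curry c k), ?_, ?_⟩
  · exact Computable.encode.comp
      (Nat.Partrec.Code.primrec₂_curry.to_comp.comp (Computable.const c) Computable.id)
  · intro k
    ext y
    simp only [Wset, phi, Denumerable.ofNat_encode, PFun.mem_dom, ← Part.dom_iff_mem,
      Nat.Partrec.Code.eval_curry, hc, Nat.unpair_pair, evenTail, Set.mem_ofPred_eq]
    by_cases h : y ≤ k ∨ y % 2 = 0 <;> simp [h]

theorem exists_index_univ : ∃ i, Wset i = Set.univ := by
  refine ⟨Encodable.encode Nat.Partrec.Code.zero, ?_⟩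
  refine Set.eq_univ_of_forall fun y => ?_
  rw [Wset, phi, Denumerable.ofNat_encode, Nat.Partrec.Code.eval]
  exact (PFun.mem_dom _ _).2 ⟨0, Part.mem_some 0⟩

/-- The largest odd number occurring in a finite sequence, or `0` if there is none. -/
def maxOdd (l : List (Option ℕ)) : ℕ :=
  l.foldr (fun o m => max (o.getD 0 * (o.getD 0 % 2)) m) 0

theorem maxOdd_cons (o : Option ℕ) (l : List (Option ℕ)) :
    maxOdd (o :: l) = max (o.getD 0 * (o.getD 0 % 2)) (maxOdd l) := rfl

theorem primrec_maxOdd : Primrec maxOdd := by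
  have ho : Primrec fun o : Option ℕ => o.getD 0 :=
    Primrec.option_getD.comp Primrec.id (Primrec.const 0)
  have hodd : Primrec fun o : Option ℕ => o.getD 0 * (o.getD 0 % 2) :=
    Primrec.nat_mul.comp ho (Primrec.nat_mod.comp ho (Primrec.const 2))
  exact Primrec.list_foldr Primrec.id (Primrec.const 0)
    (Primrec.nat_max.comp (hodd.comp (Primrec.fst.comp Primrec.snd))
      (Primrec.snd.comp Primrec.snd)).to₂

theorem le_maxOdd {l : List (Option ℕ)} {x : ℕ} (hx : some x ∈ l) (hodd : x % 2 = 1) :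
    x ≤ maxOdd l := by
  induction l with
  | nil => simp at hx
  | cons o l ih =>
    rw [maxOdd_cons]
    rcases List.mem_cons.1 hx with rfl | h
    · simp [hodd]
    · exact (ih h).trans (le_max_right _ _)

theorem maxOdd_le {l : List (Option ℕ)} {e : ℕ}
    (h : ∀ x, some x ∈ l → x ∈ evenTail e) : maxOdd l ≤ e := by
  induction l with
  | nil => simp [maxOdd]
  | cons o l ih =>
    rw [maxOdd_cons]
    refine max_le ?_ (ih fun x hx => h x (List.mem_cons_of_mem _ hx))
    cases o with
    | none => simp
    | some x =>
      have hx : x ≤ e ∨ x % 2 = 0 := h x List.mem_cons_self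
      rcases Nat.mod_two_eq_zero_or_one x with h0 | h1
      · simp [h0]
      · simp only [Option.getD_some, h1, mul_one]
        omega

/-- The learner that conjectures `ℕ`, by the index `i`, whenever the last datum is a new largest
odd number, and otherwise the set `evenTail k` for the largest odd number `k` seen, by the
index `g k`. -/
def evenTailLearner (i : ℕ) (g : ℕ → ℕ) (σ : List (Option ℕ)) : ℕ :=
  if maxOdd σ.reverse.tail < maxOdd σ.reverse then i else g (maxOdd σ.reverse)

theorem computable_evenTailLearner (i : ℕ) {g : ℕ → ℕ} (hg : Computable g) :
    Computable (evenTailLearner i g) := by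
  have hr : Primrec fun σ : List (Option ℕ) => maxOdd σ.reverse :=
    primrec_maxOdd.comp Primrec.list_reverse
  have ht : Primrec fun σ : List (Option ℕ) => maxOdd σ.reverse.tail :=
    primrec_maxOdd.comp (Primrec.list_tail.comp Primrec.list_reverse)
  have hlt : Computable fun σ : List (Option ℕ) =>
      decide (maxOdd σ.reverse.tail < maxOdd σ.reverse) :=
    (Primrec.nat_lt.comp ht hr).decide.to_comp
  refine (Computable.cond hlt (Computable.const i) (hg.comp hr.to_comp)).of_eq fun σ => ?_
  simp [evenTailLearner, cond_eq_ite]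

/-- The largest odd number among the first `n` entries of `T`. -/
def prefMaxOdd (T : ℕ → Option ℕ) (n : ℕ) : ℕ := maxOdd (pref T n).reverse

theorem prefMaxOdd_monotone (T : ℕ → Option ℕ) : Monotone (prefMaxOdd T) := by
  refine monotone_nat_of_le_succ fun n => ?_
  simp [prefMaxOdd, pref_succ, maxOdd_cons]

theorem le_prefMaxOdd {T : ℕ → Option ℕ} {n x : ℕ} (hx : T n = some x) (hodd : x % 2 = 1) :
    x ≤ prefMaxOdd T (n + 1) :=
  le_maxOdd (List.mem_reverse.2 (mem_pref.2 ⟨n, n.lt_succ_self, hx⟩)) hodd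

theorem evenTailLearner_pref_succ (i : ℕ) (g : ℕ → ℕ) (T : ℕ → Option ℕ) (n : ℕ) :
    evenTailLearner i g (pref T (n + 1)) =
      if prefMaxOdd T n < prefMaxOdd T (n + 1) then i else g (prefMaxOdd T (n + 1)) := by
  simp [evenTailLearner, prefMaxOdd, pref_succ]

section Learner

variable {i : ℕ} {g : ℕ → ℕ}

theorem evenTail_maxOdd_subset (hi : Wset i = Set.univ) (hg : ∀ k, Wset (g k) = evenTail k)
    (σ : List (Option ℕ)) :
    evenTail (maxOdd σ.reverse) ⊆ Wset (evenTailLearner i g σ) := by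
  unfold evenTailLearner
  split_ifs
  · simp [hi]
  · rw [hg]

theorem evenTailLearner_consistent (hi : Wset i = Set.univ) (hg : ∀ k, Wset (g k) = evenTail k) :
    ConsLearner (evenTailLearner i g) := by
  intro σ x hx
  apply evenTail_maxOdd_subset hi hg σ
  rcases Nat.mod_two_eq_zero_or_one x with h | h
  · exact Or.inr h
  · exact Or.inl (le_maxOdd (List.mem_reverse.2 hx) h)

theorem prefMaxOdd_unbounded {T : ℕ → Option ℕ} (hT : IsText T Set.univ) (b : ℕ) :
    ∀ᶠ n in atTop, b ≤ prefMaxOdd T n := by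
  obtain ⟨n, hn⟩ : ∃ n, T n = some (2 * b + 1) := by
    have : 2 * b + 1 ∈ {x : ℕ | ∃ n, T n = some x} := by rw [hT]; trivial
    exact this
  filter_upwards [eventually_ge_atTop (n + 1)] with m hm
  have h₁ := le_prefMaxOdd hn (by omega)
  have h₂ := prefMaxOdd_monotone T hm
  omega

/-- On texts for `evenTail e` the learner converges syntactically to a correct index. -/
theorem evenTailLearner_converges (hg : ∀ k, Wset (g k) = evenTail k) {e : ℕ}
    {T : ℕ → Option ℕ} (hT : IsText T (evenTail e)) :
    ∃ d, Wset d = evenTail e ∧ ∀ᶠ n in atTop, evenTailLearner i g (pref T n) = d := by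
  have hle : ∀ n, prefMaxOdd T n ≤ e := by
    intro n
    refine maxOdd_le fun x hx => ?_
    obtain ⟨j, -, hj⟩ := mem_pref.1 (List.mem_reverse.1 hx)
    rw [← hT]
    exact ⟨j, hj⟩
  obtain ⟨N, hN⟩ : ∃ N, ∀ n, prefMaxOdd T n ≤ prefMaxOdd T N := by
    have hfin : (Set.range (prefMaxOdd T)).Finite :=
      (Set.finite_Iic e).subset (by rintro _ ⟨n, rfl⟩; exact hle n)
    obtain ⟨_, ⟨N, rfl⟩, hmax⟩ := hfin.exists_maximal (Set.range_nonempty _)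
    refine ⟨N, fun n => ?_⟩
    rcases le_total (prefMaxOdd T n) (prefMaxOdd T N) with h | h
    · exact h
    · exact hmax ⟨n, rfl⟩ h
  have hconst : ∀ n ≥ N, prefMaxOdd T n = prefMaxOdd T N := fun n hn =>
    le_antisymm (hN n) (prefMaxOdd_monotone T hn)
  refine ⟨g (prefMaxOdd T N), ?_, ?_⟩
  · rw [hg]
    ext y
    constructor
    · rintro (h | h)
      · exact Or.inl (h.trans (hle N))
      · exact Or.inr h
    · intro hy
      rcases Nat.mod_two_eq_zero_or_one y with h | h
      · exact Or.inr h
      · rw [← hT] at hy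
        obtain ⟨n, hn⟩ := hy
        exact Or.inl ((le_prefMaxOdd hn h).trans (hN _))
  · filter_upwards [eventually_ge_atTop (N + 1)] with n hn
    obtain ⟨m, rfl⟩ : ∃ m, n = m + 1 := ⟨n - 1, by omega⟩
    rw [evenTailLearner_pref_succ, hconst m (by omega), hconst (m + 1) (by omega)]
    simp

theorem evenTailLearner_approx (hi : Wset i = Set.univ) (hg : ∀ k, Wset (g k) = evenTail k) :
    ApproxLearns (evenTailLearner i g) evenTailClass := by
  intro L hL
  refine ⟨{y | y % 2 = 0}, ?_, ?_⟩
  · refine Set.infinite_of_not_bddAbove ?_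
    rintro ⟨b, hb⟩
    have h := hb (show 2 * (b + 1) ∈ {y : ℕ | y % 2 = 0} by simp)
    omega
  intro T hT V hV
  rcases (mem_evenTailClass_iff L).1 hL with rfl | ⟨e, rfl⟩
  · obtain ⟨b, hb⟩ := hV.bddAbove
    filter_upwards [prefMaxOdd_unbounded hT b] with n hn
    refine Set.Subset.antisymm (fun y hy => ⟨trivial, hy.2⟩) fun y hy => ⟨?_, hy.2⟩
    apply evenTail_maxOdd_subset hi hg
    by_cases h : y % 2 = 0
    · exact Or.inr h
    · exact Or.inl ((hb (Or.inl ⟨hy.2, h⟩)).trans hn)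
  · obtain ⟨d, hd, hconv⟩ := evenTailLearner_converges (i := i) hg hT
    filter_upwards [hconv] with n hn
    rw [hn, hd]

theorem evenTailLearner_part (hi : Wset i = Set.univ) (hg : ∀ k, Wset (g k) = evenTail k) :
    PartLearns (evenTailLearner i g) evenTailClass := by
  intro L hL T hT
  rcases (mem_evenTailClass_iff L).1 hL with rfl | ⟨e, rfl⟩
  · refine ⟨i, ?_, hi, ?_⟩
    · rw [← Nat.frequently_atTop_iff_infinite]
      intro hev
      obtain ⟨N, hN⟩ := eventually_atTop.1 hev
      have hbound : ∀ n ≥ N, prefMaxOdd T n ≤ prefMaxOdd T N := by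
        intro n hn
        induction n, hn using Nat.le_induction with
        | base => exact le_rfl
        | succ n hn ih =>
          have h : evenTailLearner i g (pref T (n + 1)) ≠ i := hN (n + 1) (by omega)
          rw [evenTailLearner_pref_succ] at h
          by_contra hlt
          exact h (if_pos (by omega))
      obtain ⟨n, hn, hge⟩ := ((prefMaxOdd_unbounded hT (prefMaxOdd T N + 1)).and
        (eventually_ge_atTop N)).exists
      have := hbound n hge
      omega
    · intro d hd
      by_contra hne
      have hfreq := Nat.frequently_atTop_iff_infinite.2 hd
      have huniv : Wset d = Set.univ := by
        refine Set.eq_univ_of_forall fun y => ?_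
        obtain ⟨n, hn, hy⟩ := (hfreq.and_eventually (prefMaxOdd_unbounded hT y)).exists
        rw [← hn]
        exact evenTail_maxOdd_subset hi hg _ (Or.inl hy)
      obtain ⟨n, hn⟩ := hfreq.exists
      unfold evenTailLearner at hn
      split_ifs at hn
      · exact hne hn.symm
      · rw [← hn, hg] at huniv
        exact evenTail_ne_univ _ huniv
  · obtain ⟨d, hd, hconv⟩ := evenTailLearner_converges (i := i) hg hT
    refine ⟨d, Nat.frequently_atTop_iff_infinite.1 hconv.frequently, hd, fun d' hd' => ?_⟩
    obtain ⟨n, hn, hn'⟩ :=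
      ((Nat.frequently_atTop_iff_infinite.2 hd').and_eventually hconv).exists
    exact hn.symm.trans hn'

end Learner

/-- An ascending chain of finite sequences of unbounded length has a common infinite extension. -/
theorem exists_pref_eq_of_chain (s : ℕ → List (Option ℕ)) (hs : ∀ n, s n <+: s (n + 1))
    (hlen : ∀ n, n ≤ (s n).length) : ∃ T, ∀ n, pref T (s n).length = s n := by
  have hmono : ∀ m n, m ≤ n → s m <+: s n := by
    intro m n h
    induction n, h using Nat.le_induction with
    | base => exact List.prefix_refl _
    | succ n _ ih => exact ih.trans (hs n)
  refine ⟨fun j => (s (j + 1))[j]'(hlen (j + 1)), fun n => ?_⟩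
  refine List.ext_getElem (by simp [pref]) fun j h₁ h₂ => ?_
  simp only [pref, List.getElem_map, List.getElem_range]
  rcases le_total (j + 1) n with h | h
  · exact (hmono _ _ h).getElem _
  · exact ((hmono _ _ h).getElem _).symm

/-- A `BC*`-learner of `ℕ` has a locking sequence: all conjectures on extensions of it are
cofinite. -/
theorem exists_locking_univ {M : List (Option ℕ) → ℕ} {C : Set (Set ℕ)}
    (hM : BCstarLearns M C) (hC : Set.univ ∈ C) :
    ∃ σ, ∀ τ, σ <+: τ → (Wset (M τ))ᶜ.Finite := by
  by_contra! hcon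
  choose f hpre hinf using hcon
  let s : ℕ → List (Option ℕ) := fun n => Nat.rec [] (fun n l => f (l ++ [some n])) n
  have hsucc : ∀ n, s n ++ [some n] <+: s (n + 1) := fun n => hpre _
  have hlen : ∀ n, n ≤ (s n).length := by
    intro n
    induction n with
    | zero => exact Nat.zero_le _
    | succ n ih =>
      have := (hsucc n).length_le
      simp only [List.length_append, List.length_singleton] at this
      omega
  obtain ⟨T, hT⟩ := exists_pref_eq_of_chain s
    (fun n => (List.prefix_append _ _).trans (hsucc n)) hlen
  have htext : IsText T Set.univ := by
    refine Set.eq_univ_of_forall fun x => ?_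
    have hx : some x ∈ pref T (s (x + 1)).length := by
      rw [hT (x + 1)]
      exact (hsucc x).subset (by simp)
    obtain ⟨n, -, hn⟩ := mem_pref.1 hx
    exact ⟨n, hn⟩
  obtain ⟨N, hN⟩ := eventually_atTop.1 (hM _ hC T htext)
  have hfin := hN (s (N + 1)).length ((Nat.le_succ N).trans (hlen _))
  rw [hT (N + 1)] at hfin
  exact hinf (s N ++ [some N]) (hfin.subset fun y hy => Or.inr ⟨trivial, hy⟩)

/-- Every finite sequence with content in `L` extends to a text for `L`. -/
theorem exists_text_extending {L : Set ℕ} {σ : List (Option ℕ)} (hσ : ∀ x, some x ∈ σ → x ∈ L) :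
    ∃ T, IsText T L ∧ ∀ n ≥ σ.length, σ <+: pref T n := by
  classical
  let T : ℕ → Option ℕ := fun j =>
    if h : j < σ.length then σ[j]
    else if j - σ.length ∈ L then some (j - σ.length) else none
  refine ⟨T, ?_, fun n hn => ?_⟩
  · ext x
    constructor
    · rintro ⟨j, hj⟩
      simp only [T] at hj
      split_ifs at hj with h₁ h₂
      · exact hσ x (hj ▸ List.getElem_mem h₁)
      · exact Option.some.inj hj ▸ h₂
    · intro hx
      exact ⟨σ.length + x, by simp [T, hx]⟩
  · rw [List.prefix_iff_getElem]
    refine ⟨by simpa [pref] using hn, fun j hj => ?_⟩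
    simp [pref, T, hj]

theorem not_BCstarLearns_evenTailClass (M : List (Option ℕ) → ℕ) :
    ¬ BCstarLearns M evenTailClass := by
  intro hM
  obtain ⟨σ, hσ⟩ := exists_locking_univ hM ((mem_evenTailClass_iff _).2 (Or.inl rfl))
  obtain ⟨T, hT, hpre⟩ := exists_text_extending (L := evenTail (maxOdd σ)) (σ := σ) fun x hx => by
    rcases Nat.mod_two_eq_zero_or_one x with h | h
    · exact Or.inr h
    · exact Or.inl (le_maxOdd hx h)
  obtain ⟨n, hn, hge⟩ := ((hM _ ((mem_evenTailClass_iff _).2 (Or.inr ⟨_, rfl⟩)) T hT).and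
    (eventually_ge_atTop σ.length)).exists
  refine infinite_compl_evenTail (maxOdd σ) ((hn.union (hσ _ (hpre n hge))).subset fun y hy => ?_)
  by_cases h : y ∈ Wset (M (pref T n))
  · exact Or.inl (Or.inl ⟨h, hy⟩)
  · exact Or.inr h

/-- `evenTailClass` is ConsApproxPart learnable but not BC* learnable. -/
theorem stmt17 :
    (∃ M : List (Option ℕ) → ℕ, Computable M ∧ ConsLearner M ∧
       ApproxLearns M evenTailClass ∧ PartLearns M evenTailClass) ∧
    (¬ ∃ M : List (Option ℕ) → ℕ, Computable M ∧
       BCstarLearns M evenTailClass) := by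
  obtain ⟨g, hgc, hg⟩ := exists_computable_index_evenTail
  obtain ⟨i, hi⟩ := exists_index_univ
  exact ⟨⟨evenTailLearner i g, computable_evenTailLearner i hgc, evenTailLearner_consistent hi hg,
    evenTailLearner_approx hi hg, evenTailLearner_part hi hg⟩,
    fun ⟨M, _, hM⟩ => not_BCstarLearns_evenTailClass M hM⟩
end

section
/- If a class C of r.e. sets is conservatively partially (ConsvPart) learnable, then there is a single learner which simultaneously approximately (Approx) learns C, partially (Part) learns C, and BC*-learns C. -/
open Filter

open Nat.Partrec (Code)

/-- `x` is enumerated into `W_d` within `s` steps. -/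
def Seen (s d x : ℕ) : Prop := (Code.evaln s (Denumerable.ofNat Code d) x).isSome

/-- Every number occurring in `τ` is enumerated into `W_d` within `s` steps. -/
def Covers (s d : ℕ) (τ : List (Option ℕ)) : Prop := ∀ x, some x ∈ τ → Seen s d x

/-- No index in `l` covers `τ` within `s` steps. -/
def Refuted (s : ℕ) (l : List ℕ) (τ : List (Option ℕ)) : Prop := ∀ d ∈ l, ¬ Covers s d τ

/-- At stage `s`, the number `x` is enumerated into the hypothesis built from the list of
candidate indices `l` and the data `τ`. -/
def Enters (l : List ℕ) (τ : List (Option ℕ)) (x s : ℕ) : Prop :=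
  some x ∈ τ ∨ (τ.length ≤ s ∧ ∃ i < l.length, Seen s (l.getD i 0) x ∧ Covers s (l.getD i 0) τ ∧
    Refuted s (l.take i) (τ.take x))

/-- The prefix of `σ` of length `m` separates the index `d` from the earlier candidates `l`,
as far as can be seen within `s` steps. -/
def Separates (s : ℕ) (l : List ℕ) (d : ℕ) (σ : List (Option ℕ)) (m : ℕ) : Prop :=
  Refuted s l (σ.take m) ∧
    ∀ x < m, Seen s d x → some x ∈ σ.take m ∨ Refuted s l (σ.take x)

section Primrec

variable {α : Type*} [Primcodable α]

theorem primrecPred_seen {s d x : α → ℕ} (hs : Primrec s) (hd : Primrec d) (hx : Primrec x) :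
    PrimrecPred fun a => Seen (s a) (d a) (x a) :=
  (Primrec.eq.comp (Primrec.option_isSome.comp (Code.primrec_evaln.comp
    ((hs.pair ((Primrec.ofNat Code).comp hd)).pair hx))) (Primrec.const true)).of_eq
    fun _ => Iff.rfl

theorem PrimrecPred.imp {p q : α → Prop} (hp : PrimrecPred p) (hq : PrimrecPred q) :
    PrimrecPred fun a => p a → q a :=
  (hp.not.or hq).of_eq fun _ => by tauto

theorem primrecPred_forall_mem {β : Type*} [Primcodable β] {f : α → List β} {p : α → β → Prop}
    (hf : Primrec f) (hp : PrimrecRel p) : PrimrecPred fun a => ∀ b ∈ f a, p a b :=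
  hp.swap.forall_mem_list.comp hf Primrec.id

theorem primrecPred_exists_mem {β : Type*} [Primcodable β] {f : α → List β} {p : α → β → Prop}
    (hf : Primrec f) (hp : PrimrecRel p) : PrimrecPred fun a => ∃ b ∈ f a, p a b :=
  hp.swap.exists_mem_list.comp hf Primrec.id

theorem primrecPred_mem {β : Type*} [Primcodable β] {f : α → List β} {g : α → β}
    (hf : Primrec f) (hg : Primrec g) : PrimrecPred fun a => g a ∈ f a :=
  (primrecPred_exists_mem hf (p := fun a b => b = g a)
    (Primrec.eq.comp Primrec.snd (hg.comp Primrec.fst))).of_eq fun _ => by simp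

theorem primrecPred_covers {s d : α → ℕ} {τ : α → List (Option ℕ)}
    (hs : Primrec s) (hd : Primrec d) (hτ : Primrec τ) :
    PrimrecPred fun a => Covers (s a) (d a) (τ a) :=
  (primrecPred_forall_mem hτ (p := fun a y => y = Option.none ∨ Seen (s a) (d a) (y.getD 0))
    ((Primrec.eq.comp Primrec.snd (Primrec.const Option.none)).or
      (primrecPred_seen (hs.comp Primrec.fst) (hd.comp Primrec.fst)
        (Primrec.option_getD.comp Primrec.snd (Primrec.const 0))))).of_eq fun a => by
    constructor
    · intro h x hx
      simpa using h _ hx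
    · rintro h (_ | x) hx
      · simp
      · exact Or.inr (h x hx)

theorem primrecPred_refuted {s : α → ℕ} {l : α → List ℕ} {τ : α → List (Option ℕ)}
    (hs : Primrec s) (hl : Primrec l) (hτ : Primrec τ) :
    PrimrecPred fun a => Refuted (s a) (l a) (τ a) :=
  primrecPred_forall_mem hl
    (primrecPred_covers (hs.comp Primrec.fst) Primrec.snd (hτ.comp Primrec.fst)).not

theorem primrecPred_enters {l : α → List ℕ} {τ : α → List (Option ℕ)} {x s : α → ℕ}
    (hl : Primrec l) (hτ : Primrec τ) (hx : Primrec x) (hs : Primrec s) :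
    PrimrecPred fun a => Enters (l a) (τ a) (x a) (s a) := by
  have hd : Primrec fun p : α × ℕ => (l p.1).getD p.2 0 :=
    (Primrec.list_getD 0).comp (hl.comp Primrec.fst) Primrec.snd
  have key : PrimrecRel fun a i => Seen (s a) ((l a).getD i 0) (x a) ∧
      Covers (s a) ((l a).getD i 0) (τ a) ∧ Refuted (s a) ((l a).take i) ((τ a).take (x a)) :=
    (primrecPred_seen (hs.comp Primrec.fst) hd (hx.comp Primrec.fst)).and
      ((primrecPred_covers (hs.comp Primrec.fst) hd (hτ.comp Primrec.fst)).and
        (primrecPred_refuted (hs.comp Primrec.fst)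
          (Primrec.list_take.comp Primrec.snd (hl.comp Primrec.fst))
          (Primrec.list_take.comp (hx.comp Primrec.fst) (hτ.comp Primrec.fst))))
  refine ((primrecPred_mem hτ (Primrec.option_some.comp hx)).or
    ((Primrec.nat_le.comp (Primrec.list_length.comp hτ) hs).and
      (primrecPred_exists_mem (Primrec.list_range.comp (Primrec.list_length.comp hl)) key))).of_eq
    fun a => ?_
  simp [Enters]

theorem primrecPred_separates {s d m : α → ℕ} {l : α → List ℕ} {σ : α → List (Option ℕ)}
    (hs : Primrec s) (hl : Primrec l) (hd : Primrec d) (hσ : Primrec σ) (hm : Primrec m) :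
    PrimrecPred fun a => Separates (s a) (l a) (d a) (σ a) (m a) := by
  have htake : Primrec fun a => (σ a).take (m a) := Primrec.list_take.comp hm hσ
  have key : PrimrecRel fun a x => Seen (s a) (d a) x → some x ∈ (σ a).take (m a) ∨
      Refuted (s a) (l a) ((σ a).take x) :=
    (primrecPred_seen (hs.comp Primrec.fst) (hd.comp Primrec.fst) Primrec.snd).imp
      ((primrecPred_mem (htake.comp Primrec.fst) (Primrec.option_some.comp Primrec.snd)).or
        (primrecPred_refuted (hs.comp Primrec.fst) (hl.comp Primrec.fst)
          (Primrec.list_take.comp Primrec.snd (hσ.comp Primrec.fst))))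
  refine ((primrecPred_refuted hs hl htake).and
    (primrecPred_forall_mem (Primrec.list_range.comp hm) key)).of_eq fun a => ?_
  simp [Separates]

end Primrec

/-- An injective form of the s-m-n theorem for domains of partial recursive functions. -/
theorem exists_injective_index {α : Type*} [Primcodable α] {f : α → ℕ →. ℕ} (hf : Partrec₂ f) :
    ∃ h : α → ℕ, Computable h ∧ Function.Injective h ∧ ∀ a, Wset (h a) = {x | (f a x).Dom} := by
  obtain ⟨c, hc⟩ := Code.exists_code.1 hf
  refine ⟨fun a => Encodable.encode (Code.curry c (Encodable.encode a)), ?_, ?_, fun a => ?_⟩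
  · exact (Primrec.encode.comp
      (Code.primrec₂_curry.comp (Primrec.const c) Primrec.encode)).to_comp
  · intro a b hab
    exact Encodable.encode_injective (Code.curry_inj (Encodable.encode_injective hab)).2
  · ext x
    have : ((Code.curry c (Encodable.encode a)).eval x).Dom ↔ (f a x).Dom := by
      rw [Code.eval_curry, hc]
      simp [Encodable.decode_prod_val]
    simpa [Wset, phi, PFun.Dom] using this

/-- The values of a computable function on all prefixes of a list form a computable list. -/
theorem Computable.map_take {α β : Type*} [Primcodable α] [Primcodable β] {f : List α → β}
    (hf : Computable f) :
    Computable fun σ : List α => (List.range (σ.length + 1)).map fun i => f (σ.take i) := by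
  have hstep : Computable₂ fun (σ : List α) (p : ℕ × List β) => p.2 ++ [f (σ.take p.1)] :=
    Computable.list_concat.comp (Computable.snd.comp Computable.snd)
      (hf.comp (Primrec.list_take.to_comp.comp (Computable.fst.comp Computable.snd)
        Computable.fst))
  refine (Computable.nat_rec (Computable.succ.comp Computable.list_length)
    (Computable.const []) hstep).of_eq fun σ => ?_
  change _ = (List.range σ.length.succ).map _
  induction σ.length.succ with
  | zero => rfl
  | succ n ih => simp only [List.range_succ, List.map_append, ← ih, List.map_cons, List.map_nil]

theorem Seen.mono {s t d x : ℕ} (hst : s ≤ t) (h : Seen s d x) : Seen t d x := by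
  obtain ⟨y, hy⟩ := Option.isSome_iff_exists.1 h
  exact Option.isSome_iff_exists.2 ⟨y, Code.evaln_mono hst hy⟩

theorem Seen.lt {s d x : ℕ} (h : Seen s d x) : x < s := by
  obtain ⟨y, hy⟩ := Option.isSome_iff_exists.1 h
  exact Code.evaln_bound hy

theorem mem_Wset_iff_exists_seen {d x : ℕ} : x ∈ Wset d ↔ ∃ s, Seen s d x := by
  constructor
  · intro h
    obtain ⟨y, hy⟩ := Part.dom_iff_mem.1 h
    obtain ⟨s, hs⟩ := Code.evaln_complete.1 hy
    exact ⟨s, Option.isSome_iff_exists.2 ⟨y, hs⟩⟩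
  · rintro ⟨s, h⟩
    obtain ⟨y, hy⟩ := Option.isSome_iff_exists.1 h
    exact Part.dom_iff_mem.2 ⟨y, Code.evaln_sound hy⟩

theorem Seen.mem {s d x : ℕ} (h : Seen s d x) : x ∈ Wset d := mem_Wset_iff_exists_seen.2 ⟨s, h⟩

theorem eventually_seen {d x : ℕ} (h : x ∈ Wset d) : ∀ᶠ s in atTop, Seen s d x := by
  obtain ⟨s, hs⟩ := mem_Wset_iff_exists_seen.1 h
  filter_upwards [eventually_ge_atTop s] with t ht using hs.mono ht

theorem eventually_forall_seen {d : ℕ} {F : Set ℕ} (hF : F.Finite) (h : F ⊆ Wset d) :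
    ∀ᶠ s in atTop, ∀ x ∈ F, Seen s d x :=
  (eventually_all_finite hF).2 fun _ hx => eventually_seen (h hx)

theorem Refuted.anti {s t : ℕ} {l : List ℕ} {τ : List (Option ℕ)} (hst : s ≤ t)
    (h : Refuted t l τ) : Refuted s l τ :=
  fun d hd hc => h d hd fun x hx => (hc x hx).mono hst

theorem take_pref (T : ℕ → Option ℕ) (m n : ℕ) : (pref T n).take m = pref T (min m n) := by
  simp [pref, ← List.map_take, List.take_range]

theorem some_mem_pref {T : ℕ → Option ℕ} {n x : ℕ} :
    some x ∈ pref T n ↔ ∃ i < n, T i = some x := by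
  simp [pref]

theorem some_mem_pref_mono {T : ℕ → Option ℕ} {m n x : ℕ} (hmn : m ≤ n)
    (h : some x ∈ pref T m) : some x ∈ pref T n := by
  obtain ⟨i, hi, hx⟩ := some_mem_pref.1 h
  exact some_mem_pref.2 ⟨i, hi.trans_le hmn, hx⟩

theorem finite_pref (T : ℕ → Option ℕ) (n : ℕ) : {x | some x ∈ pref T n}.Finite :=
  ((pref T n).finite_toSet).preimage (Option.some_injective ℕ).injOn

theorem IsText.mem_of_mem_pref {T : ℕ → Option ℕ} {L : Set ℕ} (hT : IsText T L) {n x : ℕ}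
    (h : some x ∈ pref T n) : x ∈ L := by
  obtain ⟨i, -, hx⟩ := some_mem_pref.1 h
  exact hT ▸ ⟨i, hx⟩

theorem IsText.eventually_mem_pref {T : ℕ → Option ℕ} {L : Set ℕ} (hT : IsText T L) {x : ℕ}
    (h : x ∈ L) : ∀ᶠ n in atTop, some x ∈ pref T n := by
  rw [← hT] at h
  obtain ⟨i, hx⟩ := h
  filter_upwards [eventually_gt_atTop i] with n hn using some_mem_pref.2 ⟨i, hn, hx⟩

theorem refuted_map_range {s j : ℕ} {u : ℕ → ℕ} {τ : List (Option ℕ)} :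
    Refuted s ((List.range j).map u) τ ↔ ∀ i < j, ¬ Covers s (u i) τ := by
  simp [Refuted]

theorem Refuted.pref_mono {s p q : ℕ} {l : List ℕ} {T : ℕ → Option ℕ} (hpq : p ≤ q)
    (h : Refuted s l (pref T p)) : Refuted s l (pref T q) :=
  fun d hd hc => h d hd fun x hx => hc x (some_mem_pref_mono hpq hx)

/-- `Enters`, for the candidates `u 0, …, u j` and a prefix of a text. -/
theorem enters_pref_iff {u : ℕ → ℕ} {T : ℕ → Option ℕ} {j m x s : ℕ} :
    Enters ((List.range (j + 1)).map u) (pref T m) x s ↔ some x ∈ pref T m ∨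
      (m ≤ s ∧ ∃ i ≤ j, Seen s (u i) x ∧ Covers s (u i) (pref T m) ∧
        Refuted s ((List.range i).map u) (pref T (min x m))) := by
  have hlen : (pref T m).length = m := by simp [pref]
  simp only [Enters, hlen, List.length_map, List.length_range, take_pref, Nat.lt_succ_iff,
    ← List.map_take, List.take_range]
  refine or_congr_right (and_congr_right fun _ => exists_congr fun i => and_congr_right fun hi => ?_)
  have h1 : ((List.range (j + 1)).map u).getD i 0 = u i := by
    simp [List.getD, Nat.lt_succ_iff.2 hi]
  rw [h1, min_eq_left (by omega)]

theorem separates_pref_iff {s d m n : ℕ} {l : List ℕ} {T : ℕ → Option ℕ} (hmn : m ≤ n) :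
    Separates s l d (pref T n) m ↔ Refuted s l (pref T m) ∧
      ∀ x < m, Seen s d x → some x ∈ pref T m ∨ Refuted s l (pref T x) := by
  rw [Separates, take_pref, min_eq_left hmn]
  refine and_congr_right fun _ => forall_congr' fun x => forall_congr' fun hx => ?_
  rw [take_pref, min_eq_left (hx.le.trans hmn)]

/-- The set enumerated from candidates `l` and data `τ`. -/
def hypSet (l : List ℕ) (τ : List (Option ℕ)) : Set ℕ := {x | ∃ s, Enters l τ x s}

section Target

variable {T : ℕ → Option ℕ} {L : Set ℕ} {u : ℕ → ℕ} {k : ℕ}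

theorem eventually_refuted (hT : IsText T L) (hk : ∀ i < k, ¬ L ⊆ Wset (u i)) :
    ∀ᶠ m in atTop, ∀ s, Refuted s ((List.range k).map u) (pref T m) := by
  have : ∀ᶠ m in atTop, ∀ i ∈ Set.Iio k, ∀ s, ¬ Covers s (u i) (pref T m) := by
    refine (eventually_all_finite (Set.finite_Iio k)).2 fun i hi => ?_
    obtain ⟨z, hz, hzW⟩ := Set.not_subset.1 (hk i hi)
    filter_upwards [hT.eventually_mem_pref hz] with m hm s hc using hzW (hc z hm).mem
  filter_upwards [this] with m hm s using refuted_map_range.2 fun i hi => hm i hi s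

theorem eventually_covers (hT : IsText T L) (hL : L ⊆ Wset (u k)) (m : ℕ) :
    ∀ᶠ s in atTop, Covers s (u k) (pref T m) :=
  eventually_forall_seen (finite_pref T m) fun _ hx => hL (hT.mem_of_mem_pref hx)

/-- If no earlier candidate survives on the prefix relevant for `x`, then `x ∈ L` is enumerated
through the correct candidate. -/
theorem mem_hypSet_of_refuted (hT : IsText T L) (hL : Wset (u k) = L) {j m x : ℕ} (hkj : k ≤ j)
    (hx : x ∈ L) (h : ∀ s, Refuted s ((List.range k).map u) (pref T (min x m))) :
    x ∈ hypSet ((List.range (j + 1)).map u) (pref T m) := by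
  obtain ⟨s, hs, hcov, hseen⟩ := ((eventually_ge_atTop m).and
    ((eventually_covers hT hL.ge m).and (eventually_seen (hL.ge hx)))).exists
  exact ⟨s, enters_pref_iff.2 (Or.inr ⟨hs, k, hkj, hseen, hcov, h s⟩)⟩

/-- An element wrongly enumerated comes from a candidate later than the correct one, at a stage
at which the correct candidate does not yet cover the prefix relevant for it. -/
theorem exists_stage_of_mem_hypSet (hT : IsText T L) (hL : Wset (u k) = L) {j m x : ℕ}
    (hm : ∀ s, Refuted s ((List.range k).map u) (pref T m)) (hxL : x ∉ L)
    (hx : x ∈ hypSet ((List.range (j + 1)).map u) (pref T m)) :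
    ∃ s ≥ m, x < s ∧ k < j ∧ ¬ Covers s (u k) (pref T (min x m)) := by
  obtain ⟨s, hs⟩ := hx
  rcases enters_pref_iff.1 hs with h | ⟨hms, i, hij, hseen, hcov, href⟩
  · exact absurd (hT.mem_of_mem_pref h) hxL
  · rcases lt_trichotomy i k with hik | rfl | hki
    · exact absurd hcov (refuted_map_range.1 (hm s) i hik)
    · exact absurd (hL.le hseen.mem) hxL
    · exact ⟨s, hms, hseen.lt, hki.trans_le hij, refuted_map_range.1 href k hki⟩

/-- Hypotheses built from long data and candidates beyond the correct one include the target and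
have only finitely many errors, all of which are late. -/
theorem eventually_hypSet_of_lt (hT : IsText T L) (hL : Wset (u k) = L)
    (hk : ∀ i < k, ¬ L ⊆ Wset (u i)) {F : Set ℕ} (hF : F.Finite) (hFL : F ⊆ L) :
    ∀ᶠ m in atTop, ∀ j > k, L ⊆ hypSet ((List.range (j + 1)).map u) (pref T m) ∧
      (hypSet ((List.range (j + 1)).map u) (pref T m) \ L).Finite ∧
      ∀ x ∈ hypSet ((List.range (j + 1)).map u) (pref T m) \ L,
        ∃ z ∉ F, some z ∈ pref T x := by
  obtain ⟨m₀, hm₀⟩ := eventually_atTop.1 (eventually_refuted hT hk)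
  have hsmall : ∀ᶠ m in atTop, ∀ x ∈ L ∩ Set.Iio m₀, some x ∈ pref T m :=
    (eventually_all_finite ((Set.finite_Iio m₀).inter_of_right L)).2
      fun x hx => hT.eventually_mem_pref hx.1
  obtain ⟨B, hB⟩ := eventually_atTop.1 (eventually_forall_seen hF (hFL.trans hL.ge))
  filter_upwards [eventually_ge_atTop m₀, eventually_ge_atTop B, hsmall] with m hm hBm hsm j hj
  refine ⟨fun x hx => ?_, ?_, fun x hx => ?_⟩
  · by_cases hxm : x < m₀
    · exact ⟨0, Or.inl (hsm x ⟨hx, hxm⟩)⟩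
    · exact mem_hypSet_of_refuted hT hL hj.le hx (hm₀ _ (le_min (not_lt.1 hxm) hm))
  · obtain ⟨S, hS⟩ := eventually_atTop.1 (eventually_covers hT hL.ge m)
    refine (Set.finite_Iio S).subset fun x hx => ?_
    obtain ⟨s, -, hxs, -, hc⟩ := exists_stage_of_mem_hypSet hT hL (hm₀ m hm) hx.2 hx.1
    by_contra hSx
    exact hc fun z hz => hS s ((not_lt.1 hSx).trans hxs.le) z
      (some_mem_pref_mono (min_le_right _ _) hz)
  · obtain ⟨s, hms, -, -, hc⟩ := exists_stage_of_mem_hypSet hT hL (hm₀ m hm) hx.2 hx.1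
    by_contra! hno
    exact hc fun z hz => hB s (hBm.trans hms) z
      (by_contra fun hzF => hno z hzF (some_mem_pref_mono (min_le_left _ _) hz))

/-- The least prefix separating the correct candidate from the earlier ones stabilizes, and the
hypothesis built from it is correct. -/
theorem exists_separating_length (hT : IsText T L) (hL : Wset (u k) = L)
    (hk : ∀ i < k, ¬ L ⊆ Wset (u i)) :
    ∃ m₁, hypSet ((List.range (k + 1)).map u) (pref T m₁) = L ∧
      ∀ᶠ n in atTop, m₁ < n ∧ ∀ m ≤ m₁,
        (Separates n ((List.range k).map u) (u k) (pref T n) m ↔ m = m₁) := by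
  classical
  let R : ℕ → Prop := fun p => ∀ s, Refuted s ((List.range k).map u) (pref T p)
  let S : ℕ → Prop := fun m => R m ∧ ∀ x < m, x ∈ L → some x ∈ pref T m ∨ R x
  have hRlim : ∀ p, ∀ᶠ s in atTop, (Refuted s ((List.range k).map u) (pref T p) ↔ R p) := by
    intro p
    by_cases hp : R p
    · exact Eventually.of_forall fun s => iff_of_true (hp s) hp
    · obtain ⟨s, hs⟩ := not_forall.1 hp
      filter_upwards [eventually_ge_atTop s] with t ht
      exact iff_of_false (fun h => hs (h.anti ht)) hp
  have hseenlim : ∀ x, ∀ᶠ s in atTop, (Seen s (u k) x ↔ x ∈ L) := by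
    intro x
    by_cases hx : x ∈ L
    · filter_upwards [eventually_seen (hL.ge hx)] with s hs using iff_of_true hs hx
    · exact Eventually.of_forall fun s => iff_of_false (fun h => hx (hL.le h.mem)) hx
  have hex : ∃ m, S m := by
    obtain ⟨m₀, hm₀⟩ := eventually_atTop.1 (eventually_refuted hT hk)
    have hsmall : ∀ᶠ m in atTop, ∀ x ∈ L ∩ Set.Iio m₀, some x ∈ pref T m :=
      (eventually_all_finite ((Set.finite_Iio m₀).inter_of_right L)).2
        fun x hx => hT.eventually_mem_pref hx.1
    obtain ⟨m, hm, hsm⟩ := ((eventually_ge_atTop m₀).and hsmall).exists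
    exact ⟨m, hm₀ m hm, fun x _ hxL => (lt_or_ge x m₀).imp (fun h => hsm x ⟨hxL, h⟩) (hm₀ x)⟩
  obtain ⟨hRm, hsep⟩ := Nat.find_spec hex
  refine ⟨Nat.find hex, Set.Subset.antisymm (fun x hx => ?_) (fun x hx => ?_), ?_⟩
  · by_contra hxL
    obtain ⟨-, -, -, hkk, -⟩ := exists_stage_of_mem_hypSet hT hL hRm hxL hx
    exact lt_irrefl _ hkk
  · rcases lt_or_ge x (Nat.find hex) with hlt | hge
    · rcases hsep x hlt hx with h | h
      · exact ⟨0, Or.inl h⟩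
      · exact mem_hypSet_of_refuted hT hL le_rfl hx (by rwa [min_eq_left hlt.le])
    · exact mem_hypSet_of_refuted hT hL le_rfl hx (by rwa [min_eq_right hge])
  · have hlim : ∀ᶠ s in atTop, ∀ x ∈ Set.Iic (Nat.find hex),
        (Refuted s ((List.range k).map u) (pref T x) ↔ R x) ∧ (Seen s (u k) x ↔ x ∈ L) :=
      (eventually_all_finite (Set.finite_Iic _)).2 fun x _ => (hRlim x).and (hseenlim x)
    filter_upwards [hlim, eventually_gt_atTop (Nat.find hex)] with n hn hgt
    refine ⟨hgt, fun m hm => ?_⟩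
    have hiff : Separates n ((List.range k).map u) (u k) (pref T n) m ↔ S m := by
      rw [separates_pref_iff (hm.trans hgt.le)]
      refine and_congr (hn m hm).1 (forall_congr' fun x => forall_congr' fun hx => ?_)
      rw [(hn x (hx.le.trans hm)).1, (hn x (hx.le.trans hm)).2]
    rw [hiff]
    exact ⟨fun h => le_antisymm hm (Nat.find_min' hex h), fun h => h ▸ Nat.find_spec hex⟩

end Target

section Learner

variable (M : List (Option ℕ) → ℕ)

/-- The conjectures of `M` on all prefixes of `σ`. -/
def conjectures (σ : List (Option ℕ)) : List ℕ :=
  (List.range (σ.length + 1)).map fun i => M (σ.take i)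

/-- The length of the shortest prefix of `σ` on which `M` conjectures `M σ`. -/
def firstPos (σ : List (Option ℕ)) : ℕ := (conjectures M σ).idxOf (M σ)

open Classical in
/-- The length of the shortest proper prefix of `σ` which seems to separate `M σ` from the earlier
conjectures of `M`, or the length of `σ` if there is none. -/
noncomputable def sepLen (σ : List (Option ℕ)) : ℕ :=
  (List.range σ.length).findIdx fun m =>
    decide (Separates σ.length ((conjectures M σ).take (firstPos M σ)) (M σ) σ m)

/-- The candidates and the data from which the new hypothesis on `σ` is built. -/
noncomputable def hypData (σ : List (Option ℕ)) : List ℕ × List (Option ℕ) :=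
  ((conjectures M σ).take (firstPos M σ + 1), σ.take (sepLen M σ))

variable {M}

theorem computable_hypData (hM : Computable M) : Computable (hypData M) := by
  classical
  have hcand : Computable (conjectures M) := hM.map_take
  have hpos : Computable (firstPos M) := Primrec.list_idxOf.to_comp.comp hM hcand
  have hfind : Primrec fun a : (List ℕ × ℕ) × List (Option ℕ) =>
      (List.range a.2.length).findIdx fun m =>
        decide (Separates a.2.length a.1.1 a.1.2 a.2 m) := by
    have hσ : Primrec fun p : ((List ℕ × ℕ) × List (Option ℕ)) × ℕ => p.1.2 :=
      Primrec.snd.comp Primrec.fst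
    have ha : Primrec fun p : ((List ℕ × ℕ) × List (Option ℕ)) × ℕ => p.1.1 :=
      Primrec.fst.comp Primrec.fst
    exact Primrec.list_findIdx (Primrec.list_range.comp (Primrec.list_length.comp Primrec.snd))
      (primrecPred_separates (Primrec.list_length.comp hσ) (Primrec.fst.comp ha)
        (Primrec.snd.comp ha) hσ Primrec.snd).decide
  have hlen : Computable (sepLen M) := hfind.to_comp.comp
    (((Primrec.list_take.to_comp.comp hpos hcand).pair hM).pair Computable.id)
  exact (Primrec.list_take.to_comp.comp (Computable.succ.comp hpos) hcand).pair
    (Primrec.list_take.to_comp.comp hlen Computable.id)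

theorem hypData_pref (T : ℕ → Option ℕ) (n : ℕ) : ∃ j m,
    hypData M (pref T n) = ((List.range (j + 1)).map (fun i => M (pref T i)), pref T m) ∧
    M (pref T j) = M (pref T n) ∧ (∀ i < j, M (pref T i) ≠ M (pref T n)) ∧ m ≤ n ∧
    (m < n → Separates n ((List.range j).map fun i => M (pref T i)) (M (pref T j)) (pref T n) m) ∧
    ∀ m' < m, ¬ Separates n ((List.range j).map fun i => M (pref T i)) (M (pref T j))
      (pref T n) m' := by
  classical
  have hlen : (pref T n).length = n := by simp [pref]
  have hcand : conjectures M (pref T n) = (List.range (n + 1)).map fun i => M (pref T i) := by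
    rw [conjectures, hlen]
    refine List.map_congr_left fun i hi => ?_
    rw [take_pref, min_eq_left (Nat.lt_succ_iff.1 (List.mem_range.1 hi))]
  set j := firstPos M (pref T n) with hj
  have hmem : M (pref T n) ∈ conjectures M (pref T n) := by
    rw [hcand]
    exact List.mem_map.2 ⟨n, by simp, rfl⟩
  have hjlt : j < (conjectures M (pref T n)).length := List.idxOf_lt_length_iff.2 hmem
  have hjn : j < n + 1 := by simpa [hcand] using hjlt
  have hget : M (pref T j) = M (pref T n) := by
    calc M (pref T j) = (conjectures M (pref T n))[j] := by simp [hcand]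
      _ = M (pref T n) := List.getElem_idxOf hjlt
  have htake : ∀ i ≤ n + 1, (conjectures M (pref T n)).take i =
      (List.range i).map fun i => M (pref T i) := by
    intro i hi
    rw [hcand, ← List.map_take, List.take_range, min_eq_left hi]
  have hm : sepLen M (pref T n) = (List.range n).findIdx fun m => decide (Separates n
      ((List.range j).map fun i => M (pref T i)) (M (pref T j)) (pref T n) m) := by
    rw [sepLen, hlen, ← hj, htake j hjn.le, hget]
  have hmn : sepLen M (pref T n) ≤ n := by
    rw [hm]
    simpa using List.findIdx_le_length (xs := List.range n)
  refine ⟨j, sepLen M (pref T n), ?_, hget, fun i hi h => ?_, hmn, fun h => ?_, fun m' h => ?_⟩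
  · rw [hypData, ← hj, htake _ hjn, take_pref, min_eq_left hmn]
  · have := List.not_of_lt_findIdx (p := (· == M (pref T n))) (xs := conjectures M (pref T n)) hi
    simp [hcand] at this
    exact this h
  · rw [hm] at h ⊢
    have := List.findIdx_getElem (xs := List.range n) (w := by simpa using h)
    simpa using this
  · rw [hm] at h
    have := List.not_of_lt_findIdx h
    simpa using this

variable {C : Set (Set ℕ)} {L : Set ℕ} {T : ℕ → Option ℕ}

/-- On a text for a learned set there is a first correct conjecture, no earlier conjecture includes
the target, and all incorrect conjectures are made only finitely often. -/
theorem exists_first_correct (hP : PartLearns M C) (hV : ConsvLearner M C) (hLC : L ∈ C)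
    (hT : IsText T L) : ∃ k, Wset (M (pref T k)) = L ∧ (∀ i < k, ¬ L ⊆ Wset (M (pref T i))) ∧
      {n | M (pref T n) = M (pref T k)}.Infinite ∧
      ∀ d, {n | M (pref T n) = d}.Infinite → d = M (pref T k) := by
  classical
  obtain ⟨e, hinf, hW, huniq⟩ := hP L hLC T hT
  obtain ⟨e', -, he'⟩ := hV L hLC T hT
  have hex : ∃ n, M (pref T n) = e := hinf.nonempty
  have hfind := Nat.find_spec hex
  refine ⟨Nat.find hex, by rw [hfind, hW], fun i hi hsub => Nat.find_min hex hi ?_, ?_, ?_⟩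
  · rw [he' _ ⟨⟨i, rfl⟩, hsub⟩, he' e ⟨hex, hW.ge⟩]
  · rwa [hfind]
  · rwa [hfind]

/-- The behaviour of `hypData` on a text: eventually the candidates reach the correct conjecture,
the data separating it from the earlier ones is constant, and the data used for later candidates
gets arbitrarily long. -/
theorem eventually_hypData (hT : IsText T L) {k : ℕ} (hW : Wset (M (pref T k)) = L)
    (hk : ∀ i < k, ¬ L ⊆ Wset (M (pref T i)))
    (huniq : ∀ d, {n | M (pref T n) = d}.Infinite → d = M (pref T k)) :
    ∃ m₁, hypSet ((List.range (k + 1)).map fun i => M (pref T i)) (pref T m₁) = L ∧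
      ∀ B, ∀ᶠ n in atTop,
        ∃ j m, hypData M (pref T n) = ((List.range (j + 1)).map (fun i => M (pref T i)), pref T m) ∧
        M (pref T j) = M (pref T n) ∧ (M (pref T n) = M (pref T k) → j = k) ∧
        (j = k ∧ m = m₁ ∨ k < j ∧ B ≤ m) := by
  obtain ⟨m₁, hm₁, hlim⟩ := exists_separating_length (u := fun i => M (pref T i)) hT hW hk
  refine ⟨m₁, hm₁, fun B => ?_⟩
  have hne : ∀ i < k, M (pref T i) ≠ M (pref T k) := fun i hi h => hk i hi (by rw [h, hW])
  have hlate : ∀ᶠ n in atTop, ∀ i ∈ Set.Iio k, M (pref T n) ≠ M (pref T i) := by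
    refine (eventually_all_finite (Set.finite_Iio k)).2 fun i hi => ?_
    have hfin : {n | M (pref T n) = M (pref T i)}.Finite := by
      by_contra h
      exact hne i hi (huniq _ h)
    rw [← Nat.cofinite_eq_atTop]
    exact hfin.compl_mem_cofinite
  have hcov : ∀ᶠ n in atTop, ∀ p ∈ Set.Iio B, Covers n (M (pref T k)) (pref T p) :=
    (eventually_all_finite (Set.finite_Iio B)).2 fun p _ =>
      eventually_covers (u := fun i => M (pref T i)) hT hW.ge p
  filter_upwards [hlim, hlate, hcov, eventually_ge_atTop B] with n ⟨hmn, hsep⟩ hl hc hBn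
  obtain ⟨j, m, hdata, hj, hjmin, hm, hms, hmmin⟩ := hypData_pref (M := M) T n
  have hkj : k ≤ j := not_lt.1 fun h => hl j h hj.symm
  have hjk : M (pref T n) = M (pref T k) → j = k := fun h =>
    le_antisymm (not_lt.1 fun hlt => hjmin k hlt h.symm) hkj
  refine ⟨j, m, hdata, hj, hjk, ?_⟩
  rcases hkj.eq_or_lt with rfl | hlt
  · refine Or.inl ⟨rfl, ?_⟩
    rcases lt_trichotomy m m₁ with h | h | h
    · exact (hsep m h.le).1 (hms (h.trans hmn))
    · exact h
    · exact absurd ((hsep m₁ le_rfl).2 rfl) (hmmin m₁ h)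
  · refine Or.inr ⟨hlt, not_lt.1 fun hmB => ?_⟩
    have hS := ((separates_pref_iff hm).1 (hms (hmB.trans_le hBn))).1
    exact refuted_map_range.1 hS k hlt (hc m hmB)

/-- Almost all hypotheses include the target and have only finitely many errors, each of which is
preceded in the text by an element outside a prescribed finite set. -/
theorem eventually_hypSet_hypData (hP : PartLearns M C) (hV : ConsvLearner M C) (hLC : L ∈ C)
    (hT : IsText T L) {F : Set ℕ} (hF : F.Finite) (hFL : F ⊆ L) :
    ∀ᶠ n in atTop, L ⊆ hypSet (hypData M (pref T n)).1 (hypData M (pref T n)).2 ∧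
      (hypSet (hypData M (pref T n)).1 (hypData M (pref T n)).2 \ L).Finite ∧
      ∀ x ∈ hypSet (hypData M (pref T n)).1 (hypData M (pref T n)).2 \ L,
        ∃ z ∉ F, some z ∈ pref T x := by
  obtain ⟨k, hW, hk, -, huniq⟩ := exists_first_correct hP hV hLC hT
  obtain ⟨m₁, hm₁, hev⟩ := eventually_hypData hT hW hk huniq
  obtain ⟨B, hB⟩ := eventually_atTop.1
    (eventually_hypSet_of_lt (u := fun i => M (pref T i)) hT hW hk hF hFL)
  filter_upwards [hev B] with n ⟨j, m, hdata, _, _, hcase⟩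
  rw [hdata]
  rcases hcase with ⟨rfl, rfl⟩ | ⟨hlt, hBm⟩
  · simp [hm₁]
  · exact hB m hBm j hlt

end Learner

/-- If `C` is ConsvPart learnable then `C` is ApproxPart learnable by a BC*
learner. -/
theorem stmt18 (C : Set (Set ℕ)) (hC : ∀ L ∈ C, ∃ e, Wset e = L)
    (h : ∃ M : List (Option ℕ) → ℕ, Computable M ∧ PartLearns M C ∧ ConsvLearner M C) :
    ∃ N : List (Option ℕ) → ℕ, Computable N ∧ ApproxLearns N C ∧
      PartLearns N C ∧ BCstarLearns N C := by
  classical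
  obtain ⟨M, hM, hP, hV⟩ := h
  have hpart : Partrec₂ fun (a : List ℕ × List (Option ℕ)) (x : ℕ) =>
      Nat.rfind fun s => Part.some (decide (Enters a.1 a.2 x s)) := by
    have hdec : Primrec₂ fun (p : (List ℕ × List (Option ℕ)) × ℕ) (s : ℕ) =>
        decide (Enters p.1.1 p.1.2 p.2 s) :=
      (primrecPred_enters (Primrec.fst.comp (Primrec.fst.comp Primrec.fst))
        (Primrec.snd.comp (Primrec.fst.comp Primrec.fst)) (Primrec.snd.comp Primrec.fst)
        Primrec.snd).decide
    exact Partrec.rfind hdec.to_comp.partrec₂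
  obtain ⟨g, hg, hginj, hgW⟩ := exists_injective_index hpart
  have hW : ∀ a : List ℕ × List (Option ℕ), Wset (g a) = hypSet a.1 a.2 := by
    intro a
    rw [hgW]
    ext x
    exact (Nat.rfind_dom' (p := fun s => Part.some (decide (Enters a.1 a.2 x s)))).trans
      (by simp [hypSet])
  refine ⟨fun σ => g (hypData M σ), hg.comp (computable_hypData hM), ?_, ?_, ?_⟩
  · intro L hLC
    by_cases hfin : L.Finite
    · refine ⟨Set.univ, Set.infinite_univ, fun T hT V _ => ?_⟩
      filter_upwards [eventually_hypSet_hypData hP hV hLC hT hfin subset_rfl]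
        with n ⟨hsub, _, hlate⟩
      rw [hW, Set.Subset.antisymm (fun x hx => ?_) hsub]
      by_contra hxL
      obtain ⟨z, hz, hzT⟩ := hlate x ⟨hx, hxL⟩
      exact hz (hT.mem_of_mem_pref hzT)
    · refine ⟨L, hfin, fun T hT V hVL => ?_⟩
      have hdiff : (V \ L).Finite := hVL.subset fun x hx => Or.inl hx
      have hF : (⋃ x ∈ V \ L, {z | some z ∈ pref T x}).Finite :=
        hdiff.biUnion fun x _ => finite_pref T x
      filter_upwards [eventually_hypSet_hypData hP hV hLC hT hF (by
        simp only [Set.iUnion_subset_iff]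
        exact fun x _ z hz => hT.mem_of_mem_pref hz)] with n ⟨hsub, _, hlate⟩
      rw [hW]
      refine Set.Subset.antisymm (fun x hx => ⟨?_, hx.2⟩) (Set.inter_subset_inter_left V hsub)
      by_contra hxL
      obtain ⟨z, hz, hzT⟩ := hlate x ⟨hx.1, hxL⟩
      exact hz (Set.mem_biUnion (show x ∈ V \ L from ⟨hx.2, hxL⟩) hzT)
  · intro L hLC T hT
    obtain ⟨k, hWk, hk, hinf, huniq⟩ := exists_first_correct hP hV hLC hT
    obtain ⟨m₁, hm₁, hev⟩ := eventually_hypData hT hWk hk huniq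
    refine ⟨g ((List.range (k + 1)).map fun i => M (pref T i), pref T m₁), ?_, ?_, fun d hd => ?_⟩
    · rw [← Nat.frequently_atTop_iff_infinite] at hinf ⊢
      refine (hinf.and_eventually (hev 0)).mono ?_
      rintro n ⟨hn, j, m, hdata, -, hjk, hcase⟩
      obtain rfl := hjk hn
      rcases hcase with ⟨-, rfl⟩ | ⟨hlt, -⟩
      · exact congrArg g hdata
      · exact absurd hlt (lt_irrefl _)
    · rw [hW, hm₁]
    · rw [← Nat.frequently_atTop_iff_infinite] at hd
      have hd' := hd.and_eventually (hev 0)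
      obtain ⟨n₀, hn₀, J, m₀, hdata₀, hj₀, hjk₀, hcase₀⟩ := hd'.exists
      have hJ : M (pref T J) = M (pref T k) := by
        refine huniq _ (Nat.frequently_atTop_iff_infinite.1 (hd'.mono ?_))
        rintro n ⟨hn, j, m, hdata, hj, -, -⟩
        have heq := hginj (hn.trans hn₀.symm)
        rw [hdata, hdata₀] at heq
        have hlen := congrArg List.length (Prod.ext_iff.1 heq).1
        have : j = J := by simpa using hlen
        exact this ▸ hj.symm
      obtain rfl := hjk₀ (hj₀.symm.trans hJ)
      rcases hcase₀ with ⟨-, rfl⟩ | ⟨hlt, -⟩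
      · exact hn₀.symm.trans (congrArg g hdata₀)
      · exact absurd hlt (lt_irrefl _)
  · intro L hLC T hT
    filter_upwards [eventually_hypSet_hypData hP hV hLC hT Set.finite_empty (Set.empty_subset L)]
      with n ⟨hsub, hfin, _⟩
    rw [hW, Set.symmDiff_def, Set.sdiff_eq_empty.2 hsub, Set.union_empty]
    exact hfin
end
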